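/- arXiv:1510.02793 — 4 statements merged into one kernel-verified Lean document; each statement's English description precedes it below -/
import Mathlib

section
/- In ℝⁿ with the Euclidean metric, fix x ∈ ℝⁿ and let μ = δ_x be the Dirac mass at x. Define the premeasure on closed balls q(B_r(y)) = (1/r) ∫₀^r μ(B_s(y)) ds, so that q(B_r(y)) = (r − |y − x|)₊ / r. Then the metric outer measure ν^{q,*} obtained from q by Carathéodory's Method II construction is identically zero; in particular ν^{q,*}({x}) = 0, so Carathéodory's construction fails to recover μ. -/
open MeasureTheory Metric Set Filter Topology ENNReal Bornology

/-- Carathéodory Method II at scale `δ`: infimum of `∑ q(Bᵢ)` over countable covers of `E`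
by closed balls `Bᵢ` of diameter at most `δ`. -/
noncomputable def carPre {X : Type*} [MetricSpace X] (q : X → ℝ → ℝ≥0∞) (δ : ℝ)
    (E : Set X) : ℝ≥0∞ :=
  ⨅ (c : ℕ → X) (r : ℕ → ℝ) (_ : ∀ i, 0 < r i) (_ : ∀ i, 2 * r i ≤ δ)
    (_ : E ⊆ ⋃ i, Metric.closedBall (c i) (r i)), ∑' i, q (c i) (r i)

/-- The metric outer measure produced by Carathéodory's Method II construction
from a premeasure `q` on closed balls: `ν^{q,*}(E) = lim_{δ→0} ν^q_δ(E) = sup_{δ>0} ν^q_δ(E)`. -/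
noncomputable def carM {X : Type*} [MetricSpace X] (q : X → ℝ → ℝ≥0∞) (E : Set X) : ℝ≥0∞ :=
  ⨆ (δ : ℝ) (_ : 0 < δ), carPre q δ E

theorem carPre_eq_zero_of_cover {X : Type*} [MetricSpace X] {q : X → ℝ → ℝ≥0∞} {δ : ℝ}
    {E : Set X} (c : ℕ → X) (r : ℕ → ℝ) (hr : ∀ i, 0 < r i) (hδ : ∀ i, 2 * r i ≤ δ)
    (hE : E ⊆ ⋃ i, Metric.closedBall (c i) (r i)) (hq : ∀ i, q (c i) (r i) = 0) :
    carPre q δ E = 0 := by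
  refine le_antisymm ?_ zero_le
  calc carPre q δ E ≤ ∑' i, q (c i) (r i) :=
        iInf_le_of_le c <| iInf_le_of_le r <| iInf_le_of_le hr <| iInf_le_of_le hδ <|
          iInf_le_of_le hE le_rfl
    _ = 0 := by simp [hq]

/-- A separable nontrivial normed space is covered by countably many small closed balls, none of
which contains the given point `x` in its interior. -/
theorem exists_cover_closedBall_radius_le_dist {V : Type*} [NormedAddCommGroup V]
    [NormedSpace ℝ V] [Nontrivial V] [SecondCountableTopology V] (x : V) {ρ : ℝ} (hρ : 0 < ρ) :
    ∃ (c : ℕ → V) (r : ℕ → ℝ), (∀ i, 0 < r i) ∧ (∀ i, r i ≤ ρ) ∧ (∀ i, r i ≤ dist (c i) x) ∧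
      ⋃ i, Metric.closedBall (c i) (r i) = univ := by
  obtain ⟨v, hv⟩ := exists_norm_eq V hρ.le
  obtain ⟨w, hw⟩ := exists_ne x
  have : Nonempty ({x}ᶜ : Set V) := ⟨⟨w, hw⟩⟩
  let d := TopologicalSpace.denseSeq ({x}ᶜ : Set V)
  let c : ℕ → V := fun i => Nat.casesOn i (x + v) fun k => (d k : V)
  have hc : ∀ i, 0 < dist (c i) x := by
    rintro (_ | k)
    · simpa [c, hv] using hρ
    · exact dist_pos.2 (d k).2
  refine ⟨c, fun i => min ρ (dist (c i) x), fun i => lt_min hρ (hc i), fun i => min_le_left _ _,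
    fun i => min_le_right _ _, eq_univ_of_forall fun z => mem_iUnion.2 ?_⟩
  by_cases hz : z = x
  · exact ⟨0, by simp [c, hz, hv]⟩
  · have hzx : 0 < dist z x := dist_pos.2 hz
    obtain ⟨k, hk⟩ := (TopologicalSpace.denseRange_denseSeq ({x}ᶜ : Set V)).exists_dist_lt
      ⟨z, hz⟩ (lt_min hρ (half_pos hzx))
    have hk' : dist z (c (k + 1)) < min ρ (dist z x / 2) := hk
    obtain ⟨h₁, h₂⟩ := lt_min_iff.1 hk'
    refine ⟨k + 1, Metric.mem_closedBall.2 (le_min h₁.le ?_)⟩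
    linarith [dist_triangle z (c (k + 1)) x]

theorem carM_dirac_average_eq_zero {V : Type*} [NormedAddCommGroup V] [NormedSpace ℝ V]
    [Nontrivial V] [SecondCountableTopology V] (x : V) (E : Set V) :
    carM (fun y r => ENNReal.ofReal ((r - dist y x) / r)) E = 0 := by
  simp only [carM, ENNReal.iSup_eq_zero]
  intro δ hδ
  obtain ⟨c, r, hr, hrδ, hrx, hcov⟩ := exists_cover_closedBall_radius_le_dist x (half_pos hδ)
  refine carPre_eq_zero_of_cover c r hr (fun i => by linarith [hrδ i])
    (hcov ▸ subset_univ E) fun i => ENNReal.ofReal_of_nonpos ?_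
  exact div_nonpos_of_nonpos_of_nonneg (sub_nonpos.2 (hrx i)) (hr i).le

/-- in `ℝⁿ` (n ≥ 1), for the Dirac mass `δ_x` and the premeasure
`q(B_r(y)) = (1/r)∫₀^r δ_x(B_s(y)) ds = (r − |y − x|)₊/r`, the Method II metric outer
measure is identically zero; in particular it vanishes on `{x}`. -/
theorem stmt5 (n : ℕ) (hn : 0 < n) (x : EuclideanSpace ℝ (Fin n)) :
    (∀ E : Set (EuclideanSpace ℝ (Fin n)),
      carM (fun y r => ENNReal.ofReal ((r - dist y x) / r)) E = 0) ∧
    carM (fun y r => ENNReal.ofReal ((r - dist y x) / r)) {x} = 0 := by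
  have : NeZero n := ⟨hn.ne'⟩
  exact ⟨carM_dirac_average_eq_zero x, carM_dirac_average_eq_zero x {x}⟩
end

section
/- Let (X,d) be a separable metric space directionally (ξ,η,ζ)-limited at X and let ν be an asymptotically (α,γ)-bounded Borel measure on X (α ∈ (0,1], γ ≥ 1). Let μ be a positive Borel measure on X and let A₀ = { x ∈ X : liminf_{r→0⁺} μ(B_r(x))/ν(B_r(x)) = 0 }. Then μ(A₀) = 0. -/
open MeasureTheory Metric Set Filter Topology ENNReal Bornology

/-- `(X,d)` is directionally `(ξ,η,ζ)`-limited at `A`: for every `a ∈ A` and every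
`B ⊆ A ∩ (U_ξ(a) \ {a})` such that for all distinct `b, c ∈ B` with `d(a,b) ≥ d(a,c)`,
every `x` with `d(a,x) = d(a,c)` and `d(a,x) + d(x,b) = d(a,b)` satisfies
`d(x,c)/d(a,c) ≥ η`, the set `B` has cardinality at most `ζ`. -/
def DirLimited {X : Type*} [MetricSpace X] (A : Set X) (ξ η : ℝ) (ζ : ℕ) : Prop :=
  ∀ a ∈ A, ∀ B : Set X, B ⊆ A ∩ (Metric.ball a ξ \ {a}) →
    (∀ b ∈ B, ∀ c ∈ B, b ≠ c → dist a c ≤ dist a b →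
      ∀ x : X, dist a x = dist a c → dist a x + dist x b = dist a b →
        η ≤ dist x c / dist a c) →
    B.Finite ∧ B.ncard ≤ ζ
/-- `ν` is asymptotically `(α,γ)`-bounded: finite on bounded sets, strictly positive on
balls of positive radius, and `limsup_{r→0⁺} ν(B_r(x))/ν(B_{αr}(x)) ≤ γ` for all `x`. -/
def AsympBounded {X : Type*} [MetricSpace X] [MeasurableSpace X]
    (ν : MeasureTheory.Measure X) (α γ : ℝ) : Prop :=
  (∀ s : Set X, Bornology.IsBounded s → ν s < ⊤) ∧
  (∀ (x : X) (r : ℝ), 0 < r → 0 < ν (Metric.closedBall x r)) ∧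
  (∀ x : X, Filter.limsup
      (fun r : ℝ => ν (Metric.closedBall x r) / ν (Metric.closedBall x (α * r)))
      (nhdsWithin 0 (Set.Ioi 0)) ≤ ENNReal.ofReal γ)

/-- In a directionally limited space, a satellite configuration with ratio close to `1`, contained in
a set of small diameter, has at most `2 * ζ` satellites: at most `ζ` of them are close to the last
center, and at most `ζ` are far from it, compared with the last radius. -/
theorem DirLimited.isEmpty_satelliteConfig {X : Type*} [MetricSpace X] {ξ η : ℝ} {ζ : ℕ}
    (hη : η ≤ 1 / 3) (hdir : DirLimited (univ : Set X) ξ η ζ) {Y : Set X}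
    (hY : ∀ x ∈ Y, ∀ y ∈ Y, dist x y < ξ) :
    IsEmpty (Besicovitch.SatelliteConfig Y (2 * ζ + 1) (101 / 100)) := by
  refine ⟨fun S => ?_⟩
  set l := Fin.last (2 * ζ + 1) with hl
  have hpos (i) (hi : i < l) : 0 < dist (S.c l) (S.c i) := by
    rw [dist_comm]
    exact (S.rpos i).trans_le (S.hlast i hi).1
  have hinj : Function.Injective fun i => (S.c i : X) := by
    intro i j hij
    by_contra hne
    have hd : dist (S.c i) (S.c j) = 0 := by rw [Subtype.ext hij, dist_self]
    have hd' : dist (S.c j) (S.c i) = 0 := by rw [dist_comm, hd]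
    rcases S.h hne with h | h
    · linarith [S.rpos i]
    · linarith [S.rpos j]
  have hcard (s : Finset (Fin (2 * ζ + 1).succ)) (hs : ∀ i ∈ s, i < l)
      (hsep : ∀ i ∈ s, ∀ j ∈ s, i ≠ j → dist (S.c l) (S.c j) ≤ dist (S.c l) (S.c i) →
        dist (S.c l) (S.c i) - 2 / 3 * dist (S.c l) (S.c j) ≤ dist (S.c i) (S.c j)) :
      s.card ≤ ζ := by
    have h := (hdir (S.c l) (mem_univ _) ((fun i => (S.c i : X)) '' s) ?_ ?_).2
    · rwa [ncard_image_of_injective _ hinj, ncard_coe_finset] at h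
    · rintro _ ⟨i, hi, rfl⟩
      refine ⟨mem_univ _, hY _ (S.c i).2 _ (S.c l).2, fun h => (hs i hi).ne (hinj h)⟩
    · rintro _ ⟨i, hi, rfl⟩ _ ⟨j, hj, rfl⟩ hne hle x hx hxi
      have h := hsep i hi j hj (fun h => hne (by rw [h])) hle
      have hj0 := hpos j (hs j hj)
      simp only [Subtype.dist_eq] at h hj0
      rw [le_div_iff₀ hj0]
      have h3 := dist_triangle_left (S.c i : X) (S.c j) x
      nlinarith
  let t := Finset.Iio l
  have ht : t.card = 2 * ζ + 1 := by
    simp [t, hl]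
  have hdata (i) (hi : i < l) : S.r i ≤ dist (S.c l) (S.c i) ∧ S.r l ≤ 101 / 100 * S.r i ∧
      dist (S.c l) (S.c i) ≤ S.r i + S.r l := by
    rw [dist_comm]
    exact ⟨(S.hlast i hi).1, (S.hlast i hi).2, S.inter i hi⟩
  have hnear := hcard (t.filter fun i => dist (S.c l) (S.c i) ≤ 8 / 5 * S.r l)
    (by simp +contextual [t]) (by
      intro i hi j hj hij hle
      simp only [Finset.mem_filter, Finset.mem_Iio, t] at hi hj
      obtain ⟨hi1, hi2, hi3⟩ := hdata i hi.1
      obtain ⟨hj1, hj2, hj3⟩ := hdata j hj.1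
      have := S.rpos l
      have h := S.h hij
      beta_reduce at h
      rw [dist_comm (S.c j)] at h
      rcases h with h | h <;> linarith)
  have hfar := hcard (t.filter fun i => ¬ dist (S.c l) (S.c i) ≤ 8 / 5 * S.r l)
    (by simp +contextual [t]) (by
      intro i hi j hj hij hle
      simp only [Finset.mem_filter, Finset.mem_Iio, t, not_le] at hi hj
      obtain ⟨hi1, hi2, hi3⟩ := hdata i hi.1
      obtain ⟨hj1, hj2, hj3⟩ := hdata j hj.1
      have := S.rpos l
      have h := S.h hij
      beta_reduce at h
      rw [dist_comm (S.c j)] at h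
      rcases h with h | h <;> linarith)
  have := (Finset.card_filter_add_card_filter_not _).symm.trans_le (add_le_add hnear hfar)
  omega

/-- If Besicovitch satellite configurations in an open set `Y` are bounded in size, then any set
`s ⊆ Y` whose points are centers of arbitrarily small closed balls with `μ`-measure at most `δ`
times their `ν`-measure has `μ`-measure at most `N * (δ * ν Y)`. -/
theorem Besicovitch.measure_le_of_isEmpty_satelliteConfig {X : Type*} [MetricSpace X]
    [MeasurableSpace X] [BorelSpace X] [SecondCountableTopology X] {Y : Set X} (hYo : IsOpen Y)
    {N : ℕ} {τ : ℝ} (hτ : 1 < τ) (hN : IsEmpty (SatelliteConfig Y N τ)) {μ ν : Measure X}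
    {δ : ℝ≥0∞} {s : Set X} (hsY : s ⊆ Y)
    (hs : ∀ x ∈ s, ∃ᶠ r in 𝓝[>] (0 : ℝ), μ (closedBall x r) ≤ δ * ν (closedBall x r)) :
    μ s ≤ N * (δ * ν Y) := by
  have hex (x : s) : ∃ r : ℝ, 0 < r ∧ r ≤ 1 ∧ closedBall (x : X) r ⊆ Y ∧
      μ (closedBall (x : X) r) ≤ δ * ν (closedBall (x : X) r) := by
    obtain ⟨ε, hε, hεY⟩ := nhds_basis_closedBall.mem_iff.1 (hYo.mem_nhds (hsY x.2))
    have hsmall : ∀ᶠ r in 𝓝[>] (0 : ℝ), r ∈ Ioo 0 (min ε 1) :=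
      Ioo_mem_nhdsGT (lt_min hε one_pos)
    obtain ⟨r, hr, hr0, hr1⟩ := ((hs x x.2).and_eventually hsmall).exists
    rw [lt_min_iff] at hr1
    exact ⟨r, hr0, hr1.2.le, (closedBall_subset_closedBall hr1.1.le).trans hεY, hr⟩
  choose r hr0 hr1 hrY hr using hex
  let q : BallPackage s Y := ⟨fun x => ⟨x, hsY x.2⟩, r, hr0, 1, hr1⟩
  obtain ⟨u, hu, hcov⟩ := exist_disjoint_covering_families hτ hN q
  have hdisj (i : Fin N) : (u i).PairwiseDisjoint fun x => closedBall (x : X) (r x) := by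
    intro x hx y hy hxy
    refine Set.disjoint_left.2 fun z hzx hzy => ?_
    exact Set.disjoint_left.1 (hu i hx hy hxy)
      (show (⟨z, hrY x hzx⟩ : Y) ∈ closedBall (q.c x) (q.r x) from hzx)
      (show (⟨z, hrY x hzx⟩ : Y) ∈ closedBall (q.c y) (q.r y) from hzy)
  have hcount (i : Fin N) : (u i).Countable :=
    (hdisj i).countable_of_nonempty_interior fun x _ =>
      (nonempty_ball.2 (hr0 x)).mono ball_subset_interior_closedBall
  have hsub : s ⊆ ⋃ i : Fin N, ⋃ x ∈ u i, closedBall (x : X) (r x) := by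
    intro x hx
    have := hcov (mem_range_self ⟨x, hx⟩)
    simp only [mem_iUnion] at this ⊢
    obtain ⟨i, y, hy, hxy⟩ := this
    exact ⟨i, y, hy, ball_subset_closedBall (show x ∈ ball (y : X) (r y) from hxy)⟩
  calc μ s ≤ ∑ i : Fin N, μ (⋃ x ∈ u i, closedBall (x : X) (r x)) :=
        (measure_mono hsub).trans (measure_iUnion_fintype_le _ _)
    _ ≤ ∑ _i : Fin N, δ * ν Y := by
        refine Finset.sum_le_sum fun i _ => ?_
        calc μ (⋃ x ∈ u i, closedBall (x : X) (r x))
            ≤ ∑' x : u i, μ (closedBall (x : X) (r x)) := measure_biUnion_le _ (hcount i) _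
          _ ≤ ∑' x : u i, δ * ν (closedBall (x : X) (r x)) := ENNReal.tsum_le_tsum fun x => hr x
          _ = δ * ν (⋃ x ∈ u i, closedBall (x : X) (r x)) := by
              rw [ENNReal.tsum_mul_left,
                measure_biUnion (hcount i) (hdisj i) fun _ _ => measurableSet_closedBall]
          _ ≤ δ * ν Y := by
              gcongr
              exact iUnion₂_subset fun x _ => hrY x
    _ = N * (δ * ν Y) := by simp

/-- in a separable directionally limited metric space with an asymptotically
`(α,γ)`-bounded measure `ν`, the set `A₀` of points where
`liminf_{r→0⁺} μ(B_r(x))/ν(B_r(x)) = 0` is `μ`-null. -/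
theorem stmt10 {X : Type*} [MetricSpace X] [MeasurableSpace X] [BorelSpace X]
    [TopologicalSpace.SeparableSpace X]
    (ξ η : ℝ) (ζ : ℕ) (hξ : 0 < ξ) (hη : 0 < η) (hη' : η ≤ 1/3) (hζ : 0 < ζ)
    (hdir : DirLimited (Set.univ : Set X) ξ η ζ)
    (ν : Measure X) (α γ : ℝ) (hα : 0 < α) (hα1 : α ≤ 1) (hγ : 1 ≤ γ)
    (hν : AsympBounded ν α γ)
    (μ : Measure X) :
    μ {x : X | Filter.liminf
        (fun r : ℝ => μ (Metric.closedBall x r) / ν (Metric.closedBall x r))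
        (𝓝[>] 0) = 0} = 0 := by
  have : SecondCountableTopology X := UniformSpace.secondCountable_of_separable X
  set A : Set X := {x : X | Filter.liminf
        (fun r : ℝ => μ (Metric.closedBall x r) / ν (Metric.closedBall x r)) (𝓝[>] 0) = 0}
  have hball (p : X) : μ (A ∩ ball p (ξ / 2)) = 0 := by
    have hN : IsEmpty (Besicovitch.SatelliteConfig (ball p (ξ / 2)) (2 * ζ + 1) (101 / 100)) :=
      hdir.isEmpty_satelliteConfig hη' fun x hx y hy => by
        linarith [dist_triangle_right x y p, mem_ball.1 hx, mem_ball.1 hy]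
    have hle (δ : ℝ≥0∞) (hδ : 0 < δ) :
        μ (A ∩ ball p (ξ / 2)) ≤ ((2 * ζ + 1 : ℕ) : ℝ≥0∞) * (δ * ν (ball p (ξ / 2))) := by
      refine Besicovitch.measure_le_of_isEmpty_satelliteConfig isOpen_ball (by norm_num) hN
        inter_subset_right fun x hx => ?_
      have hlt := hx.1.trans_lt hδ
      refine ((frequently_lt_of_liminf_lt (by isBoundedDefault) hlt).and_eventually
        self_mem_nhdsWithin).mono fun r hr => ?_
      exact (ENNReal.div_le_iff (hν.2.1 x r hr.2).ne' (hν.1 _ isBounded_closedBall).ne).1 hr.1.le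
    have hlim : Tendsto (fun δ : ℝ≥0∞ => ((2 * ζ + 1 : ℕ) : ℝ≥0∞) * (δ * ν (ball p (ξ / 2))))
        (𝓝[>] 0) (𝓝 0) := by
      have hfin := (hν.1 _ (isBounded_ball (x := p) (r := ξ / 2))).ne
      have h := ENNReal.Tendsto.const_mul (a := ((2 * ζ + 1 : ℕ) : ℝ≥0∞))
        (ENNReal.Tendsto.mul_const (tendsto_id (x := 𝓝 (0 : ℝ≥0∞))) (Or.inr hfin))
        (Or.inr (ENNReal.natCast_ne_top _))
      simpa using h.mono_left nhdsWithin_le_nhds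
    exact le_antisymm (ge_of_tendsto hlim (eventually_mem_nhdsWithin.mono hle)) zero_le
  refine measure_null_of_locally_null A fun p _ => ?_
  exact ⟨A ∩ ball p (ξ / 2),
    inter_mem self_mem_nhdsWithin (mem_nhdsWithin_of_mem_nhds (ball_mem_nhds p (half_pos hξ))),
    hball p⟩
end

section
/- Let (X,d) be a separable metric space directionally (ξ,η,ζ)-limited at X and let ν be an asymptotically (α,γ)-bounded Borel measure on X (α ∈ (0,1], γ ≥ 1). Let μ be a positive Borel measure on X and fix ε₀ > 0. Then for μ-almost every x ∈ X there exists a strictly decreasing sequence (r_n)_n of positive radii converging to 0 such that μ(B_{r_n}(x)) ≤ (γ + ε₀) μ(B_{α r_n}(x)) for every n ∈ ℕ. -/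
open MeasureTheory Metric Set Filter Topology ENNReal Bornology

/-- The greedy selection in the Besicovitch covering theorem, without any hypothesis on the
metric space. -/
lemma exists_greedy_ball_cover {X : Type*} [MetricSpace X] {A : Set X} {r : X → ℝ} {R τ : ℝ}
    (hr : ∀ x ∈ A, 0 < r x ∧ r x ≤ R) (hτ : 1 < τ) :
    ∃ T ⊆ A, A ⊆ ⋃ b ∈ T, closedBall b (r b) ∧
      T.Pairwise fun b c => (r b ≤ dist b c ∧ r c ≤ τ * r b) ∨ (r c ≤ dist b c ∧ r b ≤ τ * r c) := by
  rcases A.eq_empty_or_nonempty with rfl | hA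
  · exact ⟨∅, by simp⟩
  have : Nonempty A := hA.to_subtype
  let p : Besicovitch.TauPackage A X :=
    { c := fun x => x
      r := fun x => r x
      rpos := fun x => (hr x x.2).1
      r_bound := R
      r_le := fun x => (hr x x.2).2
      τ := τ
      one_lt_tau := hτ }
  have spec : ∀ i < p.lastStep,
      p.c (p.index i) ∉ p.iUnionUpTo i ∧ p.R i ≤ p.τ * p.r (p.index i) := by
    intro i hi
    have h : p.index i =
        Classical.epsilon fun t => p.c t ∉ p.iUnionUpTo i ∧ p.R i ≤ p.τ * p.r t := by
      rw [Besicovitch.TauPackage.index]; rfl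
    rw [h]
    have : ∃ t, p.c t ∉ p.iUnionUpTo i ∧ p.R i ≤ p.τ * p.r t := by
      simpa only [not_exists, exists_prop, not_and, not_lt, not_le, mem_ofPred_eq, not_forall] using
        notMem_of_lt_csInf hi (OrderBot.bddBelow _)
    exact Classical.epsilon_spec this
  have sep : ∀ i j, i < j → j < p.lastStep →
      r (p.index i) ≤ dist (p.index i : X) (p.index j) ∧ r (p.index j) ≤ τ * r (p.index i) := by
    intro i j hij hj
    constructor
    · have := (spec j hj).1
      simp only [Besicovitch.TauPackage.iUnionUpTo, not_exists, mem_iUnion,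
        Subtype.exists] at this
      simpa only [dist_comm, mem_ball, not_lt] using this i hij
    · refine le_trans ?_ (spec i (hij.trans hj)).2
      have B : p.c (p.index j) ∉ p.iUnionUpTo i := fun H =>
        (spec j hj).1 (p.monotone_iUnionUpTo hij.le H)
      refine le_ciSup (f := fun t : { t // p.c t ∉ p.iUnionUpTo i } => p.r t) ?_ ⟨_, B⟩
      exact ⟨p.r_bound, by rintro _ ⟨u, rfl⟩; exact p.r_le _⟩
  refine ⟨(fun i => (p.index i : X)) '' Iio p.lastStep, ?_, ?_, ?_⟩
  · rintro _ ⟨i, -, rfl⟩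
    exact (p.index i).2
  · intro x hx
    have := p.mem_iUnionUpTo_lastStep ⟨x, hx⟩
    simp only [Besicovitch.TauPackage.iUnionUpTo, mem_iUnion, Subtype.exists] at this
    obtain ⟨i, hi, hxi⟩ := this
    exact mem_biUnion (mem_image_of_mem _ hi) (ball_subset_closedBall hxi)
  · rintro _ ⟨i, hi, rfl⟩ _ ⟨j, hj, rfl⟩ hne
    rcases lt_trichotomy i j with h | rfl | h
    · exact Or.inl (sep i j h hj)
    · exact absurd rfl hne
    · right
      simpa only [dist_comm] using sep j i h hi

/-- A greedily selected family of small balls in a directionally limited space has bounded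
overlap. -/
lemma DirLimited.encard_le {X : Type*} [MetricSpace X] {ξ η : ℝ} {ζ : ℕ}
    (hdir : DirLimited (univ : Set X) ξ η ζ) (hη' : η ≤ 1 / 3) {T : Set X} {r : X → ℝ}
    (hr : ∀ b ∈ T, 0 < r b ∧ r b < ξ)
    (hT : T.Pairwise fun b c =>
      (r b ≤ dist b c ∧ r c ≤ 7 / 6 * r b) ∨ (r c ≤ dist b c ∧ r b ≤ 7 / 6 * r c)) (p : X) :
    {b ∈ T | p ∈ closedBall b (r b)}.encard ≤ ζ + 1 := by
  set near := {b ∈ T | dist p b < r b / 4}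
  set far := {b ∈ T | dist p b ≤ r b ∧ r b / 4 ≤ dist p b}
  have hsub : {b ∈ T | p ∈ closedBall b (r b)} ⊆ far ∪ near := by
    rintro b ⟨hb, hpb⟩
    rw [mem_closedBall] at hpb
    rcases lt_or_ge (dist p b) (r b / 4) with h | h
    · exact Or.inr ⟨hb, h⟩
    · exact Or.inl ⟨hb, hpb, h⟩
  have hnear : near.encard ≤ 1 := by
    refine encard_le_one_iff.2 fun b c hb hc => ?_
    by_contra hne
    have h1 := hr b hb.1
    have h2 := hr c hc.1
    have h3 := dist_triangle_left b c p
    have h4 := hb.2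
    have h5 := hc.2
    rcases hT hb.1 hc.1 hne with h | h <;> linarith
  have hfar : far.encard ≤ ζ := by
    have key := hdir p (mem_univ p) far ?_ ?_
    · rw [← key.1.cast_ncard_eq]
      exact_mod_cast key.2
    · rintro b ⟨hb, h1, h2⟩
      have h3 := hr b hb
      refine ⟨mem_univ _, ?_, ?_⟩
      · rw [mem_ball, dist_comm]
        linarith
      · rintro rfl
        rw [dist_self] at h2
        linarith
    · rintro b ⟨hb, h1, h2⟩ c ⟨hc, h3, h4⟩ hne - x hx hxb
      have h5 := hr b hb
      have h6 := hr c hc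
      have hpos : 0 < dist p c := by linarith
      rw [le_div_iff₀ hpos]
      by_contra! hlt
      have h7 : η * dist p c ≤ 1 / 3 * dist p c := by gcongr
      have h8 := dist_triangle_left b c x
      rcases hT hb hc hne with h | h <;> linarith
  calc _ ≤ (far ∪ near).encard := encard_le_encard hsub
    _ ≤ far.encard + near.encard := encard_union_le _ _
    _ ≤ ζ + 1 := add_le_add hfar hnear

/-- A family of balls containing each point only finitely often is countable in a separable
space. -/
lemma countable_of_pointwise_finite_closedBall {X : Type*} [MetricSpace X]
    [TopologicalSpace.SeparableSpace X] {T : Set X} {r : X → ℝ} (hr : ∀ b ∈ T, 0 < r b)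
    (hfin : ∀ p, {b ∈ T | p ∈ closedBall b (r b)}.Finite) : T.Countable := by
  obtain ⟨D, hDc, hD⟩ := TopologicalSpace.exists_countable_dense X
  refine (hDc.biUnion fun q _ => (hfin q).countable).mono fun b hb => ?_
  obtain ⟨q, hq, hbq⟩ := hD.exists_dist_lt b (hr b hb)
  refine mem_biUnion hq ⟨hb, ?_⟩
  rw [mem_closedBall, dist_comm]
  exact hbq.le

/-- A countable family of measurable subsets of `V` with overlap at most `N` has total measure at
most `N * ν V`. -/
lemma tsum_measure_le_of_encard_le {X ι : Type*} [MeasurableSpace X] (ν : Measure X) [Countable ι]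
    {s : ι → Set X} {V : Set X} (hs : ∀ i, MeasurableSet (s i)) (hsV : ∀ i, s i ⊆ V)
    (hV : MeasurableSet V) {N : ℕ} (hN : ∀ p, {i | p ∈ s i}.encard ≤ N) :
    ∑' i, ν (s i) ≤ N * ν V := by
  calc ∑' i, ν (s i) = ∑' i, ∫⁻ p, (s i).indicator 1 p ∂ν := by
        simp_rw [lintegral_indicator_one (hs _)]
    _ = ∫⁻ p, ∑' i, (s i).indicator 1 p ∂ν :=
        (lintegral_tsum fun i => (measurable_one.indicator (hs i)).aemeasurable).symm
    _ ≤ ∫⁻ p, N * V.indicator 1 p ∂ν := by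
        refine lintegral_mono fun p => ?_
        by_cases hp : p ∈ V
        · have : ∑' i, (s i).indicator (1 : X → ℝ≥0∞) p = ∑' _ : {i | p ∈ s i}, (1 : ℝ≥0∞) := by
            rw [tsum_subtype {i | p ∈ s i} fun _ => (1 : ℝ≥0∞)]
            rfl
          rw [this, ENNReal.tsum_set_one, indicator_of_mem hp, Pi.one_apply, mul_one]
          exact (ENat.toENNReal_le.2 (hN p)).trans_eq (ENat.toENNReal_coe N)
        · have : ∀ i, (s i).indicator (1 : X → ℝ≥0∞) p = 0 := fun i =>
            indicator_of_notMem (fun h => hp (hsV i h)) _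
          simp [this]
    _ = N * ν V := by
        rw [lintegral_const_mul _ (measurable_one.indicator hV), lintegral_indicator_one hV]

/-- If arbitrarily small balls around each point of `A` have `μ`-measure negligible with respect to
their `ν`-measure, then `A` is `μ`-null. -/
lemma DirLimited.measure_eq_zero {X : Type*} [MetricSpace X] [MeasurableSpace X] [BorelSpace X]
    [TopologicalSpace.SeparableSpace X] {ξ η : ℝ} {ζ : ℕ}
    (hdir : DirLimited (univ : Set X) ξ η ζ) (hξ : 0 < ξ) (hη' : η ≤ 1 / 3) {μ ν : Measure X}
    (hν : ∀ s, IsBounded s → ν s < ⊤) {A : Set X}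
    (hA : ∀ x ∈ A, ∀ e : ℝ≥0∞, 0 < e → ∀ δ > 0, ∃ r ∈ Ioo 0 δ,
      μ (closedBall x r) ≤ e * ν (closedBall x r)) :
    μ A = 0 := by
  rcases A.eq_empty_or_nonempty with rfl | ⟨x₀, -⟩
  · simp
  suffices h : ∀ n : ℕ, μ (A ∩ closedBall x₀ n) = 0 by
    rw [← inter_univ A, ← iUnion_closedBall_nat x₀, inter_iUnion]
    exact measure_iUnion_null h
  intro n
  set V := closedBall x₀ (n + ξ)
  have hVtop : ν V < ⊤ := hν V isBounded_closedBall
  have main : ∀ e : ℝ≥0∞, 0 < e → μ (A ∩ closedBall x₀ n) ≤ e * ((ζ + 1 : ℕ) * ν V) := by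
    intro e he
    choose! r hr hμr using fun x hx => hA x hx e he ξ hξ
    obtain ⟨T, hTA, hcov, hsep⟩ := exists_greedy_ball_cover (A := A ∩ closedBall x₀ n) (r := r)
      (R := ξ) (τ := 7 / 6) (fun x hx => ⟨(hr x hx.1).1, (hr x hx.1).2.le⟩) (by norm_num)
    have hrT : ∀ b ∈ T, 0 < r b ∧ r b < ξ := fun b hb => hr b (hTA hb).1
    have hover := hdir.encard_le hη' hrT hsep
    have hcount : T.Countable := countable_of_pointwise_finite_closedBall (fun b hb => (hrT b hb).1)
      fun p => finite_of_encard_le_coe (k := ζ + 1) (by exact_mod_cast hover p)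
    have := hcount.to_subtype
    calc μ (A ∩ closedBall x₀ n) ≤ μ (⋃ b ∈ T, closedBall b (r b)) := measure_mono hcov
      _ ≤ ∑' b : T, μ (closedBall (b : X) (r b)) := measure_biUnion_le μ hcount _
      _ ≤ ∑' b : T, e * ν (closedBall (b : X) (r b)) :=
        ENNReal.tsum_le_tsum fun b => hμr b (hTA b.2).1
      _ = e * ∑' b : T, ν (closedBall (b : X) (r b)) := ENNReal.tsum_mul_left
      _ ≤ e * ((ζ + 1 : ℕ) * ν V) := by
        gcongr
        refine tsum_measure_le_of_encard_le ν (fun b => measurableSet_closedBall) (fun b => ?_)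
          measurableSet_closedBall fun p => ?_
        · refine closedBall_subset_closedBall' ?_
          have h1 := mem_closedBall.1 (hTA b.2).2
          have h2 := (hrT b b.2).2
          linarith
        · rw [← Subtype.val_injective.encard_image]
          refine (encard_le_encard ?_).trans (by exact_mod_cast hover p)
          rintro _ ⟨b, hb, rfl⟩
          exact ⟨b.2, hb⟩
  have hCtop : ((ζ + 1 : ℕ) * ν V : ℝ≥0∞) ≠ ⊤ := ENNReal.mul_ne_top (by simp) hVtop.ne
  by_contra hne
  obtain ⟨e, he, hlt⟩ := ENNReal.exists_pos_mul_lt hCtop hne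
  exact (main e he).not_gt hlt

/-- If `μ` shrinks along the scales `α ^ k` at a strictly larger rate than `ν`, then arbitrarily
small balls have negligible `μ`-measure with respect to `ν`. -/
lemma exists_measure_closedBall_le_mul {X : Type*} [MetricSpace X] [MeasurableSpace X]
    {μ ν : Measure X} {x : X} {α : ℝ} (hα : 0 < α) (hα1 : α ≤ 1) {L L' : ℝ≥0∞}
    (hL' : L' < L) (hL : L ≠ ⊤)
    (hνpos : ∀ r > 0, 0 < ν (closedBall x r))
    (hνr : ∀ᶠ r in 𝓝[>] (0 : ℝ), ν (closedBall x r) ≤ L' * ν (closedBall x (α * r)))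
    (hμr : ∀ᶠ r in 𝓝[>] (0 : ℝ), L * μ (closedBall x (α * r)) < μ (closedBall x r))
    {e : ℝ≥0∞} (he : 0 < e) {δ : ℝ} (hδ : 0 < δ) :
    ∃ r ∈ Ioo 0 δ, μ (closedBall x r) ≤ e * ν (closedBall x r) := by
  obtain ⟨u, hu, hboth⟩ := mem_nhdsGT_iff_exists_Ioo_subset.1 (hνr.and hμr)
  obtain ⟨s, hs, hsu⟩ := exists_between (lt_min (mem_Ioi.1 hu) hδ)
  have hL0 : L ≠ 0 := (bot_le.trans_lt hL').ne'
  set r₀ := α * s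
  have hr₀ : 0 < r₀ := mul_pos hα hs
  have hr₀s : r₀ ≤ s := mul_le_of_le_one_left hs.le hα1
  have hM : μ (closedBall x r₀) ≠ ⊤ := by
    intro h
    have := (hboth ⟨hs, hsu.trans_le (min_le_left _ _)⟩).2
    change L * μ (closedBall x r₀) < _ at this
    rw [h, ENNReal.mul_top hL0] at this
    exact not_top_lt this
  have hpow : ∀ k : ℕ, 0 < α ^ k * r₀ ∧ α ^ k * r₀ < min u δ := fun k =>
    ⟨by positivity, ((mul_le_of_le_one_left hr₀.le (pow_le_one₀ hα.le hα1)).trans hr₀s).trans_lt hsu⟩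
  have hμk : ∀ k : ℕ, L ^ k * μ (closedBall x (α ^ k * r₀)) ≤ μ (closedBall x r₀) := by
    intro k
    induction k with
    | zero => simp
    | succ k ih =>
      refine le_trans ?_ ih
      have := (hboth ⟨(hpow k).1, (hpow k).2.trans_le (min_le_left _ _)⟩).2.le
      rw [pow_succ, pow_succ', mul_assoc, mul_assoc]
      gcongr
  have hνk : ∀ k : ℕ, ν (closedBall x r₀) ≤ L' ^ k * ν (closedBall x (α ^ k * r₀)) := by
    intro k
    induction k with
    | zero => simp
    | succ k ih =>
      refine ih.trans ?_
      have := (hboth ⟨(hpow k).1, (hpow k).2.trans_le (min_le_left _ _)⟩).1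
      rw [pow_succ, pow_succ', mul_assoc, mul_assoc]
      gcongr
  have hq : L' / L < 1 := ENNReal.div_lt_of_lt_mul (by simpa using hL')
  have hlim : Tendsto (fun k : ℕ => (L' / L) ^ k * μ (closedBall x r₀)) atTop (𝓝 0) := by
    simpa using ENNReal.Tendsto.mul_const (ENNReal.tendsto_pow_atTop_nhds_zero_of_lt_one hq)
      (Or.inr hM)
  obtain ⟨k, hk⟩ := (hlim.eventually_lt_const
    (ENNReal.mul_pos he.ne' (hνpos r₀ hr₀).ne')).exists
  refine ⟨α ^ k * r₀, ⟨(hpow k).1, (hpow k).2.trans_le (min_le_right _ _)⟩, ?_⟩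
  have hpow_ne_zero : L' ^ k ≠ 0 := by
    intro h
    have := hνk k
    rw [h, zero_mul] at this
    exact (hνpos r₀ hr₀).not_ge this
  have hpow_ne_top : L' ^ k ≠ ⊤ := ENNReal.pow_ne_top hL'.ne_top
  rw [← ENNReal.mul_le_mul_iff_right hpow_ne_zero hpow_ne_top]
  calc L' ^ k * μ (closedBall x (α ^ k * r₀))
      = (L' / L) ^ k * (L ^ k * μ (closedBall x (α ^ k * r₀))) := by
        rw [← mul_assoc ((L' / L) ^ k), ← mul_pow, ENNReal.div_mul_cancel hL0 hL]
    _ ≤ (L' / L) ^ k * μ (closedBall x r₀) := by gcongr; exact hμk k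
    _ ≤ e * ν (closedBall x r₀) := hk.le
    _ ≤ e * (L' ^ k * ν (closedBall x (α ^ k * r₀))) := by gcongr; exact hνk k
    _ = L' ^ k * (e * ν (closedBall x (α ^ k * r₀))) := mul_left_comm _ _ _

/-- in a separable directionally limited metric space with an asymptotically
`(α,γ)`-bounded measure `ν`, for every `ε₀ > 0` and `μ`-a.e. `x` there is a strictly
decreasing sequence `r_n → 0` of positive radii with
`μ(B_{r_n}(x)) ≤ (γ + ε₀) μ(B_{α r_n}(x))` for all `n`. -/
theorem stmt11 {X : Type*} [MetricSpace X] [MeasurableSpace X] [BorelSpace X]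
    [TopologicalSpace.SeparableSpace X]
    (ξ η : ℝ) (ζ : ℕ) (hξ : 0 < ξ) (hη : 0 < η) (hη' : η ≤ 1/3) (hζ : 0 < ζ)
    (hdir : DirLimited (Set.univ : Set X) ξ η ζ)
    (ν : Measure X) (α γ : ℝ) (hα : 0 < α) (hα1 : α ≤ 1) (hγ : 1 ≤ γ)
    (hν : AsympBounded ν α γ)
    (μ : Measure X) (ε₀ : ℝ) (hε₀ : 0 < ε₀) :
    ∀ᵐ x ∂μ, ∃ r : ℕ → ℝ, StrictAnti r ∧ (∀ n, 0 < r n) ∧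
      Filter.Tendsto r Filter.atTop (𝓝 0) ∧
      ∀ n, μ (Metric.closedBall x (r n)) ≤
        ENNReal.ofReal (γ + ε₀) * μ (Metric.closedBall x (α * r n)) := by
  refine hdir.measure_eq_zero hξ hη' hν.1 fun x hx e he δ hδ => ?_
  have hγ' : ENNReal.ofReal γ < ENNReal.ofReal (γ + ε₀ / 2) :=
    (ENNReal.ofReal_lt_ofReal_iff (by linarith)).2 (by linarith)
  have hlt : ENNReal.ofReal (γ + ε₀ / 2) < ENNReal.ofReal (γ + ε₀) :=
    (ENNReal.ofReal_lt_ofReal_iff (by linarith)).2 (by linarith)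
  refine exists_measure_closedBall_le_mul hα hα1 hlt ENNReal.ofReal_ne_top (hν.2.1 x) ?_ ?_ he hδ
  · filter_upwards [eventually_lt_of_limsup_lt ((hν.2.2 x).trans_lt hγ'), self_mem_nhdsWithin]
      with r hr hr0
    exact (ENNReal.div_le_iff (hν.2.1 x _ (mul_pos hα hr0)).ne'
      (hν.1 _ isBounded_closedBall).ne).1 hr.le
  · by_contra hfreq
    refine hx ?_
    set t := {r : ℝ | 0 < r ∧ μ (closedBall x r) ≤
      ENNReal.ofReal (γ + ε₀) * μ (closedBall x (α * r))}
    have hsmall : ∀ w > 0, ∃ r ∈ t, r < w := by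
      intro w hw
      obtain ⟨r, hr, hrw⟩ := (Filter.Frequently.and_eventually
        (Filter.not_eventually.1 hfreq) (Ioo_mem_nhdsGT hw)).exists
      exact ⟨r, ⟨hrw.1, not_lt.1 hr⟩, hrw.2⟩
    have hglb : IsGLB t 0 := by
      refine ⟨fun r hr => hr.1.le, fun w hw => ?_⟩
      by_contra! hw0
      obtain ⟨r, hr, hrw⟩ := hsmall w hw0
      exact (hw hr).not_gt hrw
    obtain ⟨r, h1, h2, h3, h4⟩ := hglb.exists_seq_strictAnti_tendsto_of_notMem
      (fun h => lt_irrefl _ h.1) ((hsmall 1 one_pos).imp fun _ h => h.1)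
    exact ⟨r, h1, h2, h3, fun n => (h4 n).2⟩
end

section
/- Let (X,d) be a separable metric space directionally (ξ,η,ζ)-limited at X and let ν be an asymptotically (α,γ)-bounded Borel measure on X (α ∈ (0,1], γ ≥ 1). Let μ be a positive Borel measure on X, fix ε₀ > 0, 0 < δ < ξ/2, A ⊂ X with μ(A) < +∞, and let ℱ_δ^A = { B_r(a) : a ∈ A, 0 < r ≤ δ, μ(B_r(a)) ≤ (γ + ε₀) μ(B_{αr}(a)) }. Then for every open set U ⊂ X there exists a countable family 𝒢 of pairwise disjoint balls of ℱ_δ^A such that ∪_{B∈𝒢} B ⊂ U and μ((A ∩ U) \ ∪_{B∈𝒢} B) = 0. -/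
open MeasureTheory Metric Set Filter Topology ENNReal Bornology

/-- In a directionally limited space, every subset of small diameter has the Besicovitch covering
property. -/
theorem DirLimited.hasBesicovitchCovering {X : Type*} [MetricSpace X] {ξ η : ℝ} {ζ : ℕ}
    (hdir : DirLimited (univ : Set X) ξ η ζ) (hη : η ≤ 1 / 3) {V : Set X}
    (hV : ∀ x ∈ V, ∀ y ∈ V, dist x y < ξ) : HasBesicovitchCovering V := by
  refine ⟨2 * ζ + 1, 1.02, by norm_num, ⟨fun s => ?_⟩⟩
  set l := Fin.last (2 * ζ + 1) with hl
  let c : Fin (2 * ζ + 1).succ → X := fun i => (s.c i : X)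
  have hpos := s.rpos
  have hda : ∀ i, dist (c l) (c i) = dist (s.c i) (s.c l) := fun i => dist_comm _ _
  have hge : ∀ i < l, s.r i ≤ dist (c l) (c i) := fun i hi => (hda i).symm ▸ (s.hlast i hi).1
  have hr : ∀ i < l, s.r l ≤ 1.02 * s.r i := fun i hi => (s.hlast i hi).2
  have hle : ∀ i < l, dist (c l) (c i) ≤ s.r i + s.r l := fun i hi => (hda i).symm ▸ s.inter i hi
  have hpair : ∀ i j, i ≠ j → s.r i ≤ dist (c i) (c j) ∧ s.r j ≤ 1.02 * s.r i ∨
      s.r j ≤ dist (c i) (c j) ∧ s.r i ≤ 1.02 * s.r j := fun i j hij => by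
    simpa only [c, Subtype.dist_eq, dist_comm (s.c j : X) (s.c i)] using s.h hij
  have hinj : Function.Injective c := fun i j hij => by
    by_contra hne
    have h0 : dist (c i) (c j) = 0 := by rw [hij, dist_self]
    have hi := hpos i
    have hj := hpos j
    rcases hpair i j hne with h | h <;> linarith [h.1]
  have key : ∀ J : Finset (Fin (2 * ζ + 1).succ), (∀ i ∈ J, i < l) →
      (∀ i ∈ J, ∀ j ∈ J, i ≠ j → dist (c l) (c i) + (1 / 3 - 1) * dist (c l) (c j) ≤
        dist (c i) (c j)) → J.card ≤ ζ := by
    intro J hJ hsep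
    have := hdir (c l) (mem_univ _) (c '' J) ?_ ?_
    · simpa [Set.ncard_image_of_injective _ hinj] using this.2
    · rintro _ ⟨i, hi, rfl⟩
      exact ⟨mem_univ _, hV _ (s.c i).2 _ (s.c l).2, fun h => (hJ i hi).ne (hinj h)⟩
    · rintro _ ⟨i, hi, rfl⟩ _ ⟨j, hj, rfl⟩ hij - x hx hxb
      have h1 := hsep i hi j hj (fun h => hij (h ▸ rfl))
      have h2 := hge j (hJ j hj)
      have h3 := hpos j
      have h4 := dist_triangle (c i) x (c j)
      rw [dist_comm (c i) x] at h4
      rw [le_div_iff₀ (by linarith)]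
      nlinarith
  have hnear := key
    ((Finset.univ.filter (· < l)).filter fun i => dist (c l) (c i) ≤ 1.6 * s.r l)
    (by simp +contextual) (by
    simp only [Finset.mem_filter, Finset.mem_univ, true_and]
    rintro i ⟨hi, hi'⟩ j ⟨hj, hj'⟩ hij
    have := hge j hj
    have := hr j hj
    have := hr i hi
    have := hpos l
    rcases hpair i j hij with h | h <;> linarith [h.1])
  have hfar := key
    ((Finset.univ.filter (· < l)).filter fun i => ¬ dist (c l) (c i) ≤ 1.6 * s.r l)
    (by simp +contextual) (by
    simp only [Finset.mem_filter, Finset.mem_univ, true_and, not_le]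
    rintro i ⟨hi, hi'⟩ j ⟨hj, hj'⟩ hij
    have := hge j hj
    have := hle i hi
    have := hpos l
    have := hpos j
    rcases hpair i j hij with h | h <;> linarith [h.1, h.2])
  have hcard : (Finset.univ.filter (· < l)).card = 2 * ζ + 1 := by
    rw [show Finset.univ.filter (· < l) = Finset.Iio l by ext; simp, Fin.card_Iio]
    simp [hl]
  have hsum : ((Finset.univ.filter (· < l)).filter
        fun i => dist (c l) (c i) ≤ 1.6 * s.r l).card +
      ((Finset.univ.filter (· < l)).filter
        fun i => ¬ dist (c l) (c i) ≤ 1.6 * s.r l).card = 2 * ζ + 1 := by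
    refine Eq.trans ?_ hcard
    convert Finset.card_filter_add_card_filter_not _
  omega

/-- A countable family of pairwise disjoint closed balls, encoded as pairs `(center, radius)`,
contained in `U`, with centers in `s` and radii prescribed by `f`, that covers `φ`-almost all
of `s ∩ U`. -/
structure IsDisjointBallCover {X : Type*} [MetricSpace X] [MeasurableSpace X] (φ : Measure X)
    (f : X → Set ℝ) (s U : Set X) (G : Set (X × ℝ)) : Prop where
  countable : G.Countable
  mem : ∀ p ∈ G, p.1 ∈ s ∧ p.2 ∈ f p.1 ∧ 0 < p.2
  disjoint : G.Pairwise fun p q => Disjoint (closedBall p.1 p.2) (closedBall q.1 q.2)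
  subset : ⋃ p ∈ G, closedBall p.1 p.2 ⊆ U
  null : φ ((s ∩ U) \ ⋃ p ∈ G, closedBall p.1 p.2) = 0

section

variable {X : Type*} [MetricSpace X] [MeasurableSpace X] [BorelSpace X] [TopologicalSpace.SeparableSpace X]

theorem exists_isDisjointBallCover_of_hasBesicovitchCovering (φ : Measure X) [IsFiniteMeasure φ]
    {V : Set X} (hVo : IsOpen V) [HasBesicovitchCovering V] (f : X → Set ℝ) (s : Set X)
    (hf : ∀ x ∈ s, ∀ ρ > 0, (f x ∩ Ioo 0 ρ).Nonempty) :
    ∃ G, IsDisjointBallCover φ f s V G := by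
  have hR : ∀ x : V, ∃ R > 0, closedBall (x : X) R ⊆ V := fun x =>
    nhds_basis_closedBall.mem_iff.1 (hVo.mem_nhds x.2)
  choose R hR0 hRV using hR
  have : SecondCountableTopology X := UniformSpace.secondCountable_of_separable X
  have hfin : IsFiniteMeasure (φ.comap ((↑) : V → X)) :=
    ⟨by rw [comap_subtype_coe_apply hVo.measurableSet]; exact measure_lt_top _ _⟩
  obtain ⟨t, r, htc, hts, htf, hnull, hdisj⟩ :=
    Besicovitch.exists_disjoint_closedBall_covering_ae (φ.comap ((↑) : V → X))
      (fun x => f x) (((↑) : V → X) ⁻¹' s) (fun x hx => hf x hx) R (fun x _ => hR0 x)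
  have hball : ∀ x ∈ t, closedBall (x : X) (r x) ⊆ V := fun x hx =>
    (closedBall_subset_closedBall (htf x hx).2.2.le).trans (hRV x)
  refine ⟨(fun x : V => ((x : X), r x)) '' t, htc.image _, ?_, ?_, ?_, ?_⟩
  · rintro _ ⟨x, hx, rfl⟩
    exact ⟨hts hx, (htf x hx).1, (htf x hx).2.1⟩
  · rintro _ ⟨x, hx, rfl⟩ _ ⟨y, hy, rfl⟩ hxy
    refine disjoint_left.2 fun z hzx hzy => ?_
    have hne : x ≠ y := fun h => hxy (h ▸ rfl)
    exact (disjoint_left.1 (hdisj hx hy hne) : ∀ ⦃w : V⦄, _)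
      (show (⟨z, hball x hx hzx⟩ : V) ∈ _ from hzx) hzy
  · rw [biUnion_image]
    exact iUnion₂_subset hball
  · rw [comap_subtype_coe_apply hVo.measurableSet] at hnull
    refine measure_mono_null ?_ hnull
    rintro z ⟨⟨hzs, hzV⟩, hz⟩
    refine ⟨⟨z, hzV⟩, ⟨hzs, fun h => hz ?_⟩, rfl⟩
    simp only [mem_iUnion, biUnion_image] at h ⊢
    obtain ⟨x, hx, hzx⟩ := h
    exact ⟨x, hx, hzx⟩

/-- Disjoint fine covering in a directionally limited space. -/
theorem DirLimited.exists_isDisjointBallCover {ξ η : ℝ} {ζ : ℕ}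
    (hdir : DirLimited (univ : Set X) ξ η ζ) (hξ : 0 < ξ) (hη : η ≤ 1 / 3)
    (φ : Measure X) [IsFiniteMeasure φ] {U : Set X} (hU : IsOpen U) (f : X → Set ℝ) (s : Set X)
    (hf : ∀ x ∈ s, ∀ ρ > 0, (f x ∩ Ioo 0 ρ).Nonempty) :
    ∃ G, IsDisjointBallCover φ f s U G := by
  rcases isEmpty_or_nonempty X with hX | hX
  · exact ⟨∅, countable_empty, by simp, by simp, by simp,
      by simp [Set.eq_empty_of_isEmpty]⟩
  let y := TopologicalSpace.denseSeq X
  have hrad : ∀ n, ∃ ρ ∈ Ioo (ξ / 4) (ξ / 2), φ (frontier (ball (y n) ρ)) = 0 := fun n => by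
    simpa only [thickening_singleton] using
      exists_null_frontier_thickening φ {y n} (show ξ / 4 < ξ / 2 by linarith)
  choose ρ hρ hρ0 using hrad
  let W : ℕ → Set X := fun n => (U ∩ ball (y n) (ρ n)) \ ⋃ m ∈ Finset.range n,
    closure (ball (y m) (ρ m))
  have hWo : ∀ n, IsOpen (W n) := fun n =>
    (hU.inter isOpen_ball).sdiff
      ((Finset.range n).finite_toSet.isClosed_biUnion fun _ _ => isClosed_closure)
  have hWU : ∀ n, W n ⊆ U := fun n x hx => hx.1.1
  have hWlt : ∀ m n, m < n → Disjoint (W m) (W n) := fun m n hmn =>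
    disjoint_left.2 fun x hxm hxn => hxn.2 <|
      mem_biUnion (Finset.mem_coe.2 (Finset.mem_range.2 hmn)) (subset_closure hxm.1.2)
  have hWdisj : ∀ m n, m ≠ n → Disjoint (W m) (W n) := fun m n hmn =>
    hmn.lt_or_gt.elim (hWlt m n) fun h => (hWlt n m h).symm
  have hWcov : U \ ⋃ n, W n ⊆ ⋃ n, frontier (ball (y n) (ρ n)) := by
    classical
    rintro x ⟨hxU, hxW⟩
    have hex : ∃ n, x ∈ ball (y n) (ρ n) := by
      obtain ⟨n, hn⟩ := (TopologicalSpace.denseRange_denseSeq X).exists_dist_lt x (show 0 < ξ / 4 by linarith)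
      exact ⟨n, mem_ball.2 (hn.trans (hρ n).1)⟩
    by_contra hfr
    refine hxW (mem_iUnion.2 ⟨Nat.find hex, ⟨hxU, Nat.find_spec hex⟩, fun h => hfr ?_⟩)
    obtain ⟨m, hm, hxm⟩ := mem_iUnion₂.1 h
    refine mem_iUnion.2 ⟨m, ?_⟩
    rw [isOpen_ball.frontier_eq]
    exact ⟨hxm, Nat.find_min hex (Finset.mem_range.1 hm)⟩
  have hloc : ∀ n, ∃ G, IsDisjointBallCover φ f s (W n) G := fun n => by
    have : HasBesicovitchCovering (W n) := hdir.hasBesicovitchCovering hη fun a ha b hb => by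
      have h1 := mem_ball.1 ha.1.2
      have h2 := mem_ball.1 hb.1.2
      linarith [dist_triangle_right a b (y n), (hρ n).2]
    exact exists_isDisjointBallCover_of_hasBesicovitchCovering φ (hWo n) f s hf
  choose G hG using hloc
  have hGW : ∀ n, ∀ p ∈ G n, closedBall p.1 p.2 ⊆ W n := fun n =>
    iUnion₂_subset_iff.1 (hG n).subset
  refine ⟨⋃ n, G n, countable_iUnion fun n => (hG n).countable, ?_, ?_, ?_, ?_⟩
  · intro p hp
    obtain ⟨n, hn⟩ := mem_iUnion.1 hp
    exact (hG n).mem p hn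
  · intro p hp q hq hpq
    obtain ⟨m, hm⟩ := mem_iUnion.1 hp
    obtain ⟨n, hn⟩ := mem_iUnion.1 hq
    rcases eq_or_ne m n with rfl | hmn
    · exact (hG m).disjoint hm hn hpq
    · exact (hWdisj m n hmn).mono (hGW m p hm) (hGW n q hn)
  · refine iUnion₂_subset fun p hp => ?_
    obtain ⟨n, hn⟩ := mem_iUnion.1 hp
    exact (hGW n p hn).trans (hWU n)
  · refine measure_mono_null (t := (⋃ n, frontier (ball (y n) (ρ n))) ∪
      ⋃ n, (s ∩ W n) \ ⋃ p ∈ G n, closedBall p.1 p.2) ?_ ?_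
    · rintro x ⟨⟨hxs, hxU⟩, hx⟩
      by_cases hxW : x ∈ ⋃ n, W n
      · obtain ⟨n, hn⟩ := mem_iUnion.1 hxW
        refine Or.inr (mem_iUnion.2 ⟨n, ⟨hxs, hn⟩, fun h => hx ?_⟩)
        obtain ⟨p, hp, hxp⟩ := mem_iUnion₂.1 h
        exact mem_iUnion₂.2 ⟨p, mem_iUnion.2 ⟨n, hp⟩, hxp⟩
      · exact Or.inl (hWcov ⟨hxU, hxW⟩)
    · exact measure_union_null (measure_iUnion_null hρ0) (measure_iUnion_null fun n => (hG n).null)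

/-- In a directionally limited space, a set of points at which the lower density of `φ` with
respect to a locally bounded measure `ν` vanishes is `φ`-null. -/
theorem DirLimited.measure_null_of_density_zero {ξ η : ℝ} {ζ : ℕ}
    (hdir : DirLimited (univ : Set X) ξ η ζ) (hξ : 0 < ξ) (hη : η ≤ 1 / 3)
    (φ ν : Measure X) [IsFiniteMeasure φ] (hν : ∀ s : Set X, Bornology.IsBounded s → ν s < ⊤) (E : Set X)
    (hE : ∀ x ∈ E, ∀ ε : ℝ≥0∞, ε ≠ 0 → ∀ ρ > 0, ∃ r ∈ Ioo 0 ρ,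
      φ (closedBall x r) ≤ ε * ν (closedBall x r)) : φ E = 0 := by
  rcases isEmpty_or_nonempty X with hX | ⟨⟨x₀⟩⟩
  · simp [Set.eq_empty_of_isEmpty]
  have hcov : E ⊆ ⋃ n : ℕ, E ∩ ball x₀ n := by
    rw [← inter_iUnion, iUnion_ball_nat, inter_univ]
  refine measure_mono_null hcov (measure_iUnion_null fun n => ?_)
  have hlt : ν (ball x₀ n) < ⊤ := hν _ isBounded_ball
  have hbound : ∀ ε : ℝ≥0∞, ε ≠ 0 → φ (E ∩ ball x₀ n) ≤ ε * ν (ball x₀ n) := by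
    intro ε hε
    obtain ⟨G, hG⟩ := hdir.exists_isDisjointBallCover hξ hη φ (isOpen_ball (x := x₀) (ε := n))
      (fun x => {r | φ (closedBall x r) ≤ ε * ν (closedBall x r)}) E
      (fun x hx ρ hρ => by
        obtain ⟨r, hr, h⟩ := hE x hx ε hε ρ hρ
        exact ⟨r, h, hr⟩)
    calc φ (E ∩ ball x₀ n) ≤ φ (⋃ p ∈ G, closedBall p.1 p.2) :=
          measure_mono_ae (ae_le_set.2 hG.null)
      _ ≤ ∑' p : G, φ (closedBall p.1.1 p.1.2) := measure_biUnion_le _ hG.countable _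
      _ ≤ ∑' p : G, ε * ν (closedBall p.1.1 p.1.2) :=
          ENNReal.tsum_le_tsum fun p => (hG.mem p p.2).2.1
      _ = ε * ν (⋃ p ∈ G, closedBall p.1 p.2) := by
          rw [ENNReal.tsum_mul_left, measure_biUnion hG.countable hG.disjoint
            fun _ _ => measurableSet_closedBall]
      _ ≤ ε * ν (ball x₀ n) := by gcongr; exact hG.subset
  by_contra hne
  obtain ⟨ε, hε, hlt'⟩ := ENNReal.exists_nnreal_pos_mul_lt hlt.ne hne
  exact (hbound ε (by exact_mod_cast hε.ne')).not_gt hlt'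

end

/-- If `μ` fails to be doubling at `x` at every small scale, its lower density at `x` with respect
to an asymptotically bounded measure vanishes. -/
theorem AsympBounded.exists_measure_closedBall_le {X : Type*} [MetricSpace X] [MeasurableSpace X]
    {ν : Measure X} {α γ : ℝ} (hν : AsympBounded ν α γ) (hα : 0 < α) (hα1 : α ≤ 1) (hγ : 1 ≤ γ)
    (μ : Measure X) {ε₀ : ℝ} (hε₀ : 0 < ε₀) {x : X} {R : ℝ} (hR : 0 < R)
    (hx : ∀ r ∈ Ioo 0 R, ENNReal.ofReal (γ + ε₀) * μ (closedBall x (α * r)) < μ (closedBall x r))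
    {ε : ℝ≥0∞} (hε : ε ≠ 0) {ρ : ℝ} (hρ : 0 < ρ) :
    ∃ r ∈ Ioo 0 ρ, μ (closedBall x r) ≤ ε * ν (closedBall x r) := by
  obtain ⟨hbdd, hpos, hlim⟩ := hν
  set c := ENNReal.ofReal (γ + ε₀) with hc
  set c' := ENNReal.ofReal (γ + ε₀ / 2)
  have hc0 : c ≠ 0 := by simp [hc]; linarith
  have hcc : c' < c := (ENNReal.ofReal_lt_ofReal_iff (by linarith)).2 (by linarith)
  have hνfin : ∀ r, ν (closedBall x r) ≠ ⊤ := fun r => (hbdd _ isBounded_closedBall).ne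
  obtain ⟨S, hS, hSν⟩ : ∃ S > 0, ∀ r ∈ Ioo 0 S,
      ν (closedBall x r) ≤ c' * ν (closedBall x (α * r)) := by
    have hlt : ENNReal.ofReal γ < c' :=
      (ENNReal.ofReal_lt_ofReal_iff (by linarith)).2 (by linarith)
    have hev := eventually_lt_of_limsup_lt ((hlim x).trans_lt hlt)
    obtain ⟨S, hS, hsub⟩ := mem_nhdsGT_iff_exists_Ioo_subset.1 hev
    refine ⟨S, hS, fun r hr => ?_⟩
    exact (ENNReal.div_le_iff (hpos x _ (mul_pos hα hr.1)).ne' (hνfin _)).1 (hsub hr).le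
  set T := min R (min S ρ)
  have hT0 : 0 < T := lt_min hR (lt_min hS hρ)
  obtain ⟨r, hr, hrfin⟩ : ∃ r ∈ Ioo 0 T, μ (closedBall x r) ≠ ⊤ := by
    have hmem : T / 2 ∈ Ioo 0 R := ⟨by linarith, by linarith [min_le_left R (min S ρ)]⟩
    refine ⟨α * (T / 2), ⟨by positivity, by nlinarith⟩, fun h => ?_⟩
    have := hx _ hmem
    rw [h, ENNReal.mul_top hc0] at this
    exact not_top_lt this
  have hrk : ∀ k : ℕ, α ^ k * r ∈ Ioo 0 T := fun k =>
    ⟨mul_pos (pow_pos hα k) hr.1,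
      (mul_le_of_le_one_left hr.1.le (pow_le_one₀ hα.le hα1)).trans_lt hr.2⟩
  have hTR : T ≤ R := min_le_left _ _
  have hTS : T ≤ S := (min_le_right _ _).trans (min_le_left _ _)
  have hTρ : T ≤ ρ := (min_le_right _ _).trans (min_le_right _ _)
  have hμk : ∀ k : ℕ, c ^ k * μ (closedBall x (α ^ k * r)) ≤ μ (closedBall x r) := by
    intro k
    induction k with
    | zero => simp
    | succ k ih =>
      refine le_trans ?_ ih
      have := hx _ ⟨(hrk k).1, (hrk k).2.trans_le hTR⟩
      rw [pow_succ, mul_assoc, pow_succ', mul_assoc]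
      gcongr
  have hνk : ∀ k : ℕ, ν (closedBall x r) ≤ c' ^ k * ν (closedBall x (α ^ k * r)) := by
    intro k
    induction k with
    | zero => simp
    | succ k ih =>
      refine ih.trans ?_
      have := hSν _ ⟨(hrk k).1, (hrk k).2.trans_le hTS⟩
      rw [pow_succ c', mul_assoc, pow_succ' α, mul_assoc]
      gcongr
  set K := μ (closedBall x r) / ν (closedBall x r) with hK
  have hν0 : ν (closedBall x r) ≠ 0 := (hpos x r hr.1).ne'
  have hKfin : K ≠ ⊤ := ENNReal.div_ne_top hrfin hν0
  obtain ⟨k, hk⟩ : ∃ k : ℕ, K * (c' / c) ^ k < ε := by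
    have hlt1 : c' / c < 1 :=
      ENNReal.div_lt_of_lt_mul (by rwa [one_mul])
    have := ENNReal.Tendsto.const_mul (ENNReal.tendsto_pow_atTop_nhds_zero_of_lt_one hlt1)
      (Or.inr hKfin)
    rw [mul_zero] at this
    exact (this.eventually_lt_const (pos_iff_ne_zero.2 hε)).exists
  refine ⟨α ^ k * r, ⟨(hrk k).1, (hrk k).2.trans_le hTρ⟩, ?_⟩
  have hck0 : c ^ k ≠ 0 := pow_ne_zero _ hc0
  have hckt : c ^ k ≠ ⊤ := ENNReal.pow_ne_top ENNReal.ofReal_ne_top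
  calc μ (closedBall x (α ^ k * r)) ≤ μ (closedBall x r) / c ^ k := by
        rw [ENNReal.le_div_iff_mul_le (Or.inl hck0) (Or.inl hckt), mul_comm]
        exact hμk k
    _ = K * ν (closedBall x r) / c ^ k := by rw [hK, ENNReal.div_mul_cancel hν0 (hνfin r)]
    _ ≤ K * (c' ^ k * ν (closedBall x (α ^ k * r))) / c ^ k := by gcongr; exact hνk k
    _ = K * (c' / c) ^ k * ν (closedBall x (α ^ k * r)) := by
        rw [div_eq_mul_inv c' c, mul_pow, ← ENNReal.inv_pow, div_eq_mul_inv]; ring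
    _ ≤ ε * ν (closedBall x (α ^ k * r)) := by gcongr

/-- Besicovitch with doubling balls, filling part: if `μ(A) < ∞` then for
every open `U` there is a countable family `𝒢` of pairwise disjoint balls of
`ℱ_δ^A = {B_r(a) : a ∈ A, 0 < r ≤ δ, μ(B_r(a)) ≤ (γ+ε₀) μ(B_{αr}(a))}` whose union is
contained in `U` and covers `μ`-almost all of `A ∩ U`. -/
theorem stmt13 {X : Type*} [MetricSpace X] [MeasurableSpace X] [BorelSpace X]
    [TopologicalSpace.SeparableSpace X]
    (ξ η : ℝ) (ζ : ℕ) (hξ : 0 < ξ) (hη : 0 < η) (hη' : η ≤ 1/3) (hζ : 0 < ζ)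
    (hdir : DirLimited (Set.univ : Set X) ξ η ζ)
    (ν : Measure X) (α γ : ℝ) (hα : 0 < α) (hα1 : α ≤ 1) (hγ : 1 ≤ γ)
    (hν : AsympBounded ν α γ)
    (μ : Measure X) (ε₀ δ : ℝ) (hε₀ : 0 < ε₀) (hδ : 0 < δ) (hδξ : δ < ξ / 2)
    (A : Set X) (hA : μ A < ⊤) :
    ∀ U : Set X, IsOpen U →
      ∃ G : Set (X × ℝ),
        G.Countable ∧
        (∀ p ∈ G, p.1 ∈ A ∧ 0 < p.2 ∧ p.2 ≤ δ ∧
          μ (Metric.closedBall p.1 p.2) ≤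
            ENNReal.ofReal (γ + ε₀) * μ (Metric.closedBall p.1 (α * p.2))) ∧
        (G.Pairwise fun p p' =>
          Disjoint (Metric.closedBall p.1 p.2) (Metric.closedBall p'.1 p'.2)) ∧
        (⋃ p ∈ G, Metric.closedBall p.1 p.2) ⊆ U ∧
        μ ((A ∩ U) \ ⋃ p ∈ G, Metric.closedBall p.1 p.2) = 0 := by
  intro U hU
  have hAS := subset_toMeasurable μ A
  have hSm := measurableSet_toMeasurable μ A
  set φ := μ.restrict (toMeasurable μ A) with hφ
  have : IsFiniteMeasure φ := ⟨by simpa [hφ, measure_toMeasurable] using hA⟩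
  let f : X → Set ℝ := fun x => {r | r ≤ δ ∧
    μ (closedBall x r) ≤ ENNReal.ofReal (γ + ε₀) * μ (closedBall x (α * r))}
  let E : Set X := {x | ∃ R > 0, f x ∩ Ioo 0 R = ∅}
  have hE : φ E = 0 := by
    refine hdir.measure_null_of_density_zero hξ hη' φ ν hν.1 E ?_
    rintro x ⟨R, hR, hfx⟩ ε hε ρ hρ
    obtain ⟨r, hr, h⟩ := hν.exists_measure_closedBall_le hα hα1 hγ μ hε₀ (x := x)
      (lt_min hR hδ) (fun r hr => by
        by_contra! hle
        have hmem : r ∈ f x ∩ Ioo 0 R :=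
          ⟨⟨(hr.2.trans_le (min_le_right _ _)).le, hle⟩, hr.1, hr.2.trans_le (min_le_left _ _)⟩
        rw [hfx] at hmem
        exact hmem) hε hρ
    exact ⟨r, hr, (Measure.restrict_apply_le _ _).trans h⟩
  obtain ⟨G, hG⟩ := hdir.exists_isDisjointBallCover hξ hη' φ hU f (A \ E) (fun x hx ρ hρ => by
    by_contra hne
    exact hx.2 ⟨ρ, hρ, not_nonempty_iff_eq_empty.1 hne⟩)
  refine ⟨G, hG.countable, fun p hp => ?_, hG.disjoint, hG.subset, ?_⟩
  · obtain ⟨hpA, ⟨hpδ, hpμ⟩, hp0⟩ := hG.mem p hp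
    exact ⟨hpA.1, hp0, hpδ, hpμ⟩
  · have hnull : φ ((A ∩ U) \ ⋃ p ∈ G, closedBall p.1 p.2) = 0 := by
      refine measure_mono_null (fun x hx => ?_) (measure_union_null hE hG.null)
      by_cases hxE : x ∈ E
      · exact Or.inl hxE
      · exact Or.inr ⟨⟨⟨hx.1.1, hxE⟩, hx.1.2⟩, hx.2⟩
    rwa [hφ, Measure.restrict_apply' hSm,
      inter_eq_left.2 (fun x hx => hAS hx.1.1)] at hnull
end
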